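/- Let M(λ) ∈ F[λ]^{m×(m+n)} be a polynomial matrix of degree at most d with full row normal rank m, let S_k be its Sylvester matrices, r_k = rank(S_k) and n_k = k(m+n) − r_k. If d' is the smallest index k for which n_{k+1} − n_k = n (equivalently, r_{k+1} − r_k = m), then d' equals the maximum right minimal index of M(λ), i.e., the maximum row degree of any minimal basis of N_r(M). Moreover, for every k ≥ d' the equality n_{k+1} − n_k = n (equivalently r_{k+1} − r_k = m) continues to hold. -/

import Mathlib

open Polynomial Matrix

noncomputable section

variable {F : Type*} [Field F]

/-- The rows of a polynomial matrix, viewed as vectors of rational functions. -/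
def ratRow {p q : ℕ} (M : Matrix (Fin p) (Fin q) F[X]) (i : Fin p) :
    Fin q → RatFunc F :=
  fun j => algebraMap F[X] (RatFunc F) (M i j)

/-- The rational vector subspace spanned by the rows of a polynomial matrix. -/
def rowSpan {p q : ℕ} (M : Matrix (Fin p) (Fin q) F[X]) :
    Submodule (RatFunc F) (Fin q → RatFunc F) :=
  Submodule.span (RatFunc F) (Set.range (ratRow M))

/-- The degree of the `i`-th row of a polynomial matrix. -/
def rowDeg {p q : ℕ} (M : Matrix (Fin p) (Fin q) F[X]) (i : Fin p) : ℕ :=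
  Finset.univ.sup fun j => (M i j).natDegree

/-- The rows of `M` form a polynomial basis of the rational subspace `V` whose sum of
row degrees is minimal among all polynomial bases of `V`. -/
def IsMinimalBasisOf {p q : ℕ} (V : Submodule (RatFunc F) (Fin q → RatFunc F))
    (M : Matrix (Fin p) (Fin q) F[X]) : Prop :=
  LinearIndependent (RatFunc F) (ratRow M) ∧ rowSpan M = V ∧
    ∀ M' : Matrix (Fin p) (Fin q) F[X],
      LinearIndependent (RatFunc F) (ratRow M') → rowSpan M' = V →
        ∑ i, rowDeg M i ≤ ∑ i, rowDeg M' i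

/-- A polynomial matrix is a minimal basis if its rows form a minimal basis of the
rational subspace they span. -/
def IsMinimalBasis {p q : ℕ} (M : Matrix (Fin p) (Fin q) F[X]) : Prop :=
  IsMinimalBasisOf (rowSpan M) M

/-- A polynomial matrix viewed as a matrix of rational functions. -/
def ratMat {p q : ℕ} (M : Matrix (Fin p) (Fin q) F[X]) :
    Matrix (Fin p) (Fin q) (RatFunc F) :=
  M.map (algebraMap F[X] (RatFunc F))

/-- The right null-space over `F(λ)` of a polynomial matrix. -/
def rightNullSpace {p q : ℕ} (M : Matrix (Fin p) (Fin q) F[X]) :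
    Submodule (RatFunc F) (Fin q → RatFunc F) :=
  LinearMap.ker (Matrix.mulVecLin (ratMat M))

/-- The `k`-th Sylvester matrix of a polynomial matrix regarded as having degree at
most `e`: the block-Toeplitz matrix with `k` block columns whose `j`-th block column
carries the coefficients `M_0, …, M_e` in block rows `j, …, j+e` and zeros elsewhere. -/
def sylv {p q : ℕ} (e k : ℕ) (M : Matrix (Fin p) (Fin q) F[X]) :
    Matrix (Fin (k + e) × Fin p) (Fin k × Fin q) F :=
  fun r c =>
    if (c.1 : ℕ) ≤ (r.1 : ℕ) ∧ (r.1 : ℕ) ≤ (c.1 : ℕ) + e then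
      (M r.2 c.2).coeff ((r.1 : ℕ) - (c.1 : ℕ))
    else 0

/-- `M`, regarded as a polynomial matrix of degree at most `e`, has
full-Sylvester-rank if every Sylvester matrix `S_k`, `k ≥ 1`, has full rank. -/
def HasFullSylvesterRank {p q : ℕ} (e : ℕ) (M : Matrix (Fin p) (Fin q) F[X]) : Prop :=
  ∀ k : ℕ, 1 ≤ k → (sylv e k M).rank = min ((k + e) * p) (k * q)

/-- The `k`-th coefficient matrix of a polynomial matrix. -/
def coeffMat {p q : ℕ} (k : ℕ) (M : Matrix (Fin p) (Fin q) F[X]) :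
    Matrix (Fin p) (Fin q) F :=
  fun i j => (M i j).coeff k

/-- The highest-row-degree coefficient matrix: its `i`-th row is the coefficient of
`λ^{d_i}` in the `i`-th row of `M`, where `d_i` is the `i`-th row degree. -/
def highRowMat {p q : ℕ} (M : Matrix (Fin p) (Fin q) F[X]) :
    Matrix (Fin p) (Fin q) F :=
  fun i j => (M i j).coeff (rowDeg M i)

/-- The `e`-reversal of a polynomial matrix: `rev_e P(λ) = λ^e P(1/λ)`. -/
def revMat {p q : ℕ} (e : ℕ) (P : Matrix (Fin p) (Fin q) F[X]) :
    Matrix (Fin p) (Fin q) F[X] :=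
  fun i j => (P i j).reflect e

/-- A polynomial vector viewed as a vector of rational functions. -/
def ratVec {q : ℕ} : (Fin q → F[X]) →ₗ[F[X]] (Fin q → RatFunc F) :=
  (Algebra.linearMap F[X] (RatFunc F)).compLeft (Fin q)

lemma ratVec_injective {q : ℕ} : Function.Injective (ratVec : (Fin q → F[X]) → _) :=
  (IsFractionRing.injective F[X] (RatFunc F)).comp_left

lemma ratRow_eq_ratVec {p q : ℕ} (N : Matrix (Fin p) (Fin q) F[X]) (i : Fin p) :
    ratRow N i = ratVec (N i) := rfl

lemma ratVec_vecMul {p q : ℕ} (N : Matrix (Fin p) (Fin q) F[X]) (c : Fin p → F[X]) :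
    ratVec (c ᵥ* N) = ∑ i, algebraMap F[X] (RatFunc F) (c i) • ratRow N i := by
  simp [Matrix.vecMul_eq_sum, map_sum, ratRow_eq_ratVec, algebraMap_smul]

lemma ratVec_mem_rightNullSpace {p q : ℕ} (M : Matrix (Fin p) (Fin q) F[X])
    (x : Fin q → F[X]) : ratVec x ∈ rightNullSpace M ↔ M *ᵥ x = 0 := by
  have h : ratMat M *ᵥ ratVec x = ratVec (M *ᵥ x) := by
    funext i
    exact (RingHom.map_mulVec (algebraMap F[X] (RatFunc F)) M x i).symm
  rw [rightNullSpace, LinearMap.mem_ker, Matrix.mulVecLin_apply, h,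
    map_eq_zero_iff ratVec ratVec_injective]

lemma vecMul_injective {p q : ℕ} {N : Matrix (Fin p) (Fin q) F[X]}
    (hN : LinearIndependent (RatFunc F) (ratRow N)) :
    Function.Injective fun c : Fin p → F[X] => c ᵥ* N := by
  intro a b hab
  have h := congrArg ratVec hab
  simp only [ratVec_vecMul] at h
  funext i
  exact IsFractionRing.injective F[X] (RatFunc F)
    (hN.fintypeLinearCombination_injective
      (a₁ := fun i => algebraMap F[X] (RatFunc F) (a i))
      (a₂ := fun i => algebraMap F[X] (RatFunc F) (b i))
      (by simpa [Fintype.linearCombination_apply] using h) |> congrFun <| i)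

/-- A polynomial vector in the span of the rows is, up to a common denominator, a
polynomial combination of the rows. -/
lemma exists_smul_eq_vecMul {p q : ℕ} {N : Matrix (Fin p) (Fin q) F[X]} {x : Fin q → F[X]}
    (hx : ratVec x ∈ rowSpan N) :
    ∃ D : F[X], D ≠ 0 ∧ ∃ c : Fin p → F[X], D • x = c ᵥ* N := by
  obtain ⟨a, ha⟩ := (Submodule.mem_span_range_iff_exists_fun (RatFunc F)).mp hx
  obtain ⟨D, hD⟩ := IsLocalization.exist_integer_multiples_of_finite
    (nonZeroDivisors F[X]) a
  choose c hc using hD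
  refine ⟨D, nonZeroDivisors.coe_ne_zero D, c, ratVec_injective ?_⟩
  rw [ratVec_vecMul, map_smul, ← ha, Finset.smul_sum]
  refine Finset.sum_congr rfl fun i _ => ?_
  rw [hc, smul_assoc]

/-- The row degrees of a minimal basis are optimal for the exchange of a single row. -/
lemma IsMinimalBasisOf.rowDeg_lt {p q k : ℕ}
    {V : Submodule (RatFunc F) (Fin q → RatFunc F)} {N : Matrix (Fin p) (Fin q) F[X]}
    (hN : IsMinimalBasisOf V N) {x : Fin q → F[X]} {D : F[X]} (hD : D ≠ 0)
    {c : Fin p → F[X]} (h : D • x = c ᵥ* N) {j : Fin p} (hj : c j ≠ 0)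
    (hx : ∀ t, x t ∈ degreeLT F k) : rowDeg N j < k := by
  obtain ⟨hli, hspan, hmin⟩ := hN
  have hx0 : x ≠ 0 := by
    rintro rfl
    have : c = 0 := vecMul_injective hli (by simpa using h.symm)
    exact hj (by simp [this])
  set N' := N.updateRow j x with hN'
  have hself : ratRow N' j = ratVec x := by simp [ratRow_eq_ratVec, hN']
  have hother : ∀ i, i ≠ j → ratRow N' i = ratRow N i := fun i hi => by
    simp [ratRow_eq_ratVec, hN', Matrix.updateRow_ne hi]
  have hDF : algebraMap F[X] (RatFunc F) D ≠ 0 := by simpa using hD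
  have hcF : algebraMap F[X] (RatFunc F) (c j) ≠ 0 := by simpa using hj
  have hrel : algebraMap F[X] (RatFunc F) D • ratVec x =
      ∑ i, algebraMap F[X] (RatFunc F) (c i) • ratRow N i := by
    rw [← ratVec_vecMul, ← h, map_smul, algebraMap_smul]
  have hspan' : rowSpan N' = rowSpan N := by
    apply le_antisymm
    · refine Submodule.span_le.mpr ?_
      rintro _ ⟨i, rfl⟩
      by_cases hi : i = j
      · subst hi
        rw [hself, SetLike.mem_coe, ← Submodule.smul_mem_iff _ hDF, hrel]
        exact Submodule.sum_mem _ fun i _ =>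
          Submodule.smul_mem _ _ (Submodule.subset_span ⟨i, rfl⟩)
      · rw [hother i hi]
        exact Submodule.subset_span ⟨i, rfl⟩
    · refine Submodule.span_le.mpr ?_
      have hmem : ∀ i, i ≠ j → ratRow N i ∈ rowSpan N' := fun i hi =>
        hother i hi ▸ Submodule.subset_span ⟨i, rfl⟩
      rintro _ ⟨i, rfl⟩
      by_cases hi : i = j
      · subst hi
        rw [SetLike.mem_coe, ← Submodule.smul_mem_iff _ hcF]
        rw [← Finset.add_sum_erase _ _ (Finset.mem_univ i), ← sub_eq_iff_eq_add] at hrel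
        rw [← hrel, ← hself]
        exact Submodule.sub_mem _
          (Submodule.smul_mem _ _ (Submodule.subset_span ⟨i, rfl⟩))
          (Submodule.sum_mem _ fun l hl =>
            Submodule.smul_mem _ _ (hmem l (Finset.ne_of_mem_erase hl)))
      · exact hmem i hi
  have hli' : LinearIndependent (RatFunc F) (ratRow N') := by
    rw [linearIndependent_iff_card_eq_finrank_span] at hli ⊢
    rw [hli]
    exact congrArg (fun W : Submodule _ _ => Module.finrank (RatFunc F) W) hspan'.symm
  have hle := hmin N' hli' (hspan'.trans hspan)
  rw [← Finset.add_sum_erase _ _ (Finset.mem_univ j),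
    ← Finset.add_sum_erase _ (rowDeg N') (Finset.mem_univ j)] at hle
  have hrest : ∑ i ∈ Finset.univ.erase j, rowDeg N' i =
      ∑ i ∈ Finset.univ.erase j, rowDeg N i :=
    Finset.sum_congr rfl fun i hi => by
      simp [rowDeg, hN', Matrix.updateRow_ne (Finset.ne_of_mem_erase hi)]
  have hk : 0 < k := by
    obtain ⟨t, ht⟩ := Function.ne_iff.mp hx0
    by_contra hk
    have := mem_degreeLT.mp (hx t)
    obtain rfl : k = 0 := by omega
    exact ht (by simpa using this)
  have hdegx : rowDeg N' j < k := by
    rw [rowDeg, Finset.sup_lt_iff (by simpa using hk)]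
    intro t _
    simp only [hN', Matrix.updateRow_self]
    by_cases h0 : x t = 0
    · simpa [h0] using hk
    · exact (natDegree_lt_iff_degree_lt h0).mpr (mem_degreeLT.mp (hx t))
  omega

lemma natDegree_le_rowDeg {p q : ℕ} (N : Matrix (Fin p) (Fin q) F[X]) (i : Fin p)
    (t : Fin q) : (N i t).natDegree ≤ rowDeg N i :=
  Finset.le_sup (f := fun t => (N i t).natDegree) (Finset.mem_univ t)

lemma vecMul_mem_degreeLT {p q k : ℕ} (N : Matrix (Fin p) (Fin q) F[X])
    {c : Fin p → F[X]} (hc : ∀ i, c i ≠ 0 → (c i).natDegree + rowDeg N i < k) (t : Fin q) :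
    (c ᵥ* N) t ∈ degreeLT F k := by
  simp only [Matrix.vecMul, dotProduct]
  refine Submodule.sum_mem _ fun i _ => ?_
  by_cases h0 : c i = 0
  · simp [h0]
  · rw [mem_degreeLT]
    have h1 := hc i h0
    have h2 := natDegree_le_rowDeg N i t
    have h3 : (c i * N i t).natDegree ≤ (c i).natDegree + (N i t).natDegree :=
      natDegree_mul_le
    exact degree_le_natDegree.trans_lt (by exact_mod_cast (by omega))

/-- The rows of a minimal basis generate all polynomial vectors of their rational span. -/
lemma IsMinimalBasisOf.exists_eq_vecMul {p q : ℕ}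
    {V : Submodule (RatFunc F) (Fin q → RatFunc F)} {N : Matrix (Fin p) (Fin q) F[X]}
    (hN : IsMinimalBasisOf V N) {x : Fin q → F[X]} (hx : ratVec x ∈ V) :
    ∃ c : Fin p → F[X], x = c ᵥ* N := by
  classical
  rw [← hN.2.1] at hx
  obtain ⟨D, hD, c, h⟩ := exists_smul_eq_vecMul hx
  have hrem : D • (x - (fun i => c i / D) ᵥ* N) = (fun i => c i % D) ᵥ* N := by
    rw [smul_sub, h, ← Matrix.smul_vecMul, ← Matrix.sub_vecMul]
    congr 1
    funext i
    have := EuclideanDomain.div_add_mod (c i) D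
    simp only [Pi.sub_apply, Pi.smul_apply, smul_eq_mul]
    linear_combination -this
  by_cases hr : ∀ i, c i % D = 0
  · refine ⟨fun i => c i / D, ?_⟩
    have h0 : (fun i => c i % D) ᵥ* N = 0 := by
      rw [show (fun i => c i % D) = 0 from funext hr, Matrix.zero_vecMul]
    rw [h0] at hrem
    exact sub_eq_zero.mp ((smul_eq_zero.mp hrem).resolve_left hD)
  · push Not at hr
    obtain ⟨i₀, hi₀⟩ := hr
    obtain ⟨j, hj, hmax⟩ := Finset.exists_max_image
      (Finset.univ.filter fun i => c i % D ≠ 0) (rowDeg N) ⟨i₀, by simpa using hi₀⟩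
    have hj' : c j % D ≠ 0 := by simpa using hj
    refine absurd (hN.rowDeg_lt (k := rowDeg N j) hD hrem hj' fun t => ?_) (lt_irrefl _)
    have hlt : D * (x - (fun i => c i / D) ᵥ* N) t ∈ degreeLT F (D.natDegree + rowDeg N j) := by
      have := vecMul_mem_degreeLT N (c := fun i => c i % D)
        (k := D.natDegree + rowDeg N j) (fun i hi => by
          have h1 := hmax i (by simpa using hi)
          have h2 := natDegree_lt_natDegree hi (EuclideanDomain.mod_lt (c i) hD)
          omega) t
      rwa [← hrem] at this
    by_cases h0 : (x - (fun i => c i / D) ᵥ* N) t = 0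
    · rw [h0]; exact Submodule.zero_mem _
    · rw [mem_degreeLT, ← natDegree_lt_iff_degree_lt (mul_ne_zero hD h0),
        natDegree_mul hD h0] at hlt
      rw [mem_degreeLT, ← natDegree_lt_iff_degree_lt h0]
      omega

/-- The predictable degree property of minimal bases. -/
lemma IsMinimalBasisOf.natDegree_add_rowDeg_lt {p q k : ℕ}
    {V : Submodule (RatFunc F) (Fin q → RatFunc F)} {N : Matrix (Fin p) (Fin q) F[X]}
    (hN : IsMinimalBasisOf V N) {c : Fin p → F[X]}
    (hx : ∀ t, (c ᵥ* N) t ∈ degreeLT F k) {i : Fin p} (hi : c i ≠ 0) :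
    (c i).natDegree + rowDeg N i < k := by
  classical
  by_contra! hk
  obtain ⟨i₁, hi₁, hmax₁⟩ := Finset.exists_max_image
    (Finset.univ.filter fun i => c i ≠ 0) (fun i => (c i).natDegree + rowDeg N i)
    ⟨i, by simpa using hi⟩
  set μ := (c i₁).natDegree + rowDeg N i₁ with hμ
  have hkμ : k ≤ μ := hk.trans (hmax₁ i (by simpa using hi))
  have hle : ∀ l, c l ≠ 0 → (c l).natDegree + rowDeg N l ≤ μ := fun l hl =>
    hmax₁ l (by simpa using hl)
  obtain ⟨j, hj, hmax⟩ := Finset.exists_max_image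
    (Finset.univ.filter fun l => c l ≠ 0 ∧ (c l).natDegree + rowDeg N l = μ) (rowDeg N)
    ⟨i₁, by simpa [hμ] using hi₁⟩
  obtain ⟨hj0, hjμ⟩ : c j ≠ 0 ∧ (c j).natDegree + rowDeg N j = μ := by simpa using hj
  let b : Fin p → F[X] := fun l =>
    if c l ≠ 0 ∧ (c l).natDegree + rowDeg N l = μ then
      monomial (rowDeg N j - rowDeg N l) (c l).leadingCoeff else 0
  have hbj : b j ≠ 0 := by simp [b, hj0, hjμ]
  refine absurd (hN.rowDeg_lt (k := rowDeg N j) one_ne_zero (one_smul _ (b ᵥ* N)) hbj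
    fun t => ?_) (lt_irrefl _)
  have hdeg : (b ᵥ* N) t ∈ degreeLT F (rowDeg N j + 1) := by
    refine vecMul_mem_degreeLT N (fun l hl => ?_) t
    have hl' : c l ≠ 0 ∧ (c l).natDegree + rowDeg N l = μ := by
      by_contra h
      exact hl (if_neg h)
    have h1 := hmax l (by simpa using hl')
    have h2 : (b l).natDegree ≤ rowDeg N j - rowDeg N l := by
      simp only [b, if_pos hl']
      exact natDegree_monomial_le _
    omega
  have htop : ((b ᵥ* N) t).coeff (rowDeg N j) = ((c ᵥ* N) t).coeff μ := by
    simp only [Matrix.vecMul, dotProduct, finsetSum_coeff]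
    refine Finset.sum_congr rfl fun l _ => ?_
    have hNl := natDegree_le_rowDeg N l t
    by_cases hl : c l ≠ 0 ∧ (c l).natDegree + rowDeg N l = μ
    · have h1 := hmax l (by simpa using hl)
      rw [← hl.2, coeff_mul_add_eq_of_natDegree_le le_rfl hNl]
      simp only [b, if_pos hl]
      conv_lhs => rw [← Nat.sub_add_cancel h1]
      rw [Nat.add_sub_cancel_right, coeff_mul_add_eq_of_natDegree_le (natDegree_monomial_le _) hNl,
        coeff_monomial_same]
      rfl
    · simp only [b, if_neg hl, zero_mul, coeff_zero]
      by_cases h0 : c l = 0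
      · simp [h0]
      · have := hle l h0
        have h2 : (c l).natDegree + rowDeg N l ≠ μ := fun h => hl ⟨h0, h⟩
        refine (coeff_eq_zero_of_natDegree_lt ?_).symm
        have : (c l * N l t).natDegree ≤ (c l).natDegree + (N l t).natDegree :=
          natDegree_mul_le
        omega
  have hzero : ((c ᵥ* N) t).coeff μ = 0 :=
    (degree_lt_iff_coeff_zero _ _).mp (mem_degreeLT.mp (hx t)) μ hkμ
  rw [mem_degreeLT, degree_lt_iff_coeff_zero] at hdeg ⊢
  intro s hs
  rcases hs.eq_or_lt with rfl | hs
  · rw [htop, hzero]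
  · exact hdeg s hs

/-- The polynomial null vectors of `M` with entries of degree less than `k`. -/
def nullLT {p q : ℕ} (M : Matrix (Fin p) (Fin q) F[X]) (k : ℕ) :
    Submodule F (Fin q → F[X]) where
  carrier := {x | (∀ t, x t ∈ degreeLT F k) ∧ M *ᵥ x = 0}
  add_mem' hx hy := ⟨fun t => Submodule.add_mem _ (hx.1 t) (hy.1 t), by
    rw [Matrix.mulVec_add, hx.2, hy.2, add_zero]⟩
  zero_mem' := ⟨fun _ => Submodule.zero_mem _, Matrix.mulVec_zero _⟩
  smul_mem' a x hx := ⟨fun t => Submodule.smul_mem _ _ (hx.1 t), by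
    rw [Matrix.mulVec_smul, hx.2, smul_zero]⟩

lemma mem_nullLT {p q k : ℕ} {M : Matrix (Fin p) (Fin q) F[X]} {x : Fin q → F[X]} :
    x ∈ nullLT M k ↔ (∀ t, x t ∈ degreeLT F k) ∧ M *ᵥ x = 0 := Iff.rfl

lemma IsMinimalBasisOf.finrank_nullLT {p q r : ℕ} {M : Matrix (Fin p) (Fin q) F[X]}
    {N : Matrix (Fin r) (Fin q) F[X]} (hN : IsMinimalBasisOf (rightNullSpace M) N) (k : ℕ) :
    Module.finrank F (nullLT M k) = ∑ i, (k - rowDeg N i) := by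
  let f : (∀ i, degreeLT F (k - rowDeg N i)) →ₗ[F] (Fin q → F[X]) :=
    (N.vecMulLinear.restrictScalars F) ∘ₗ
      LinearMap.pi fun i => (degreeLT F (k - rowDeg N i)).subtype ∘ₗ LinearMap.proj i
  have hf : ∀ c, f c = (fun i => (c i : F[X])) ᵥ* N := fun c => rfl
  have hinj : Function.Injective f := by
    intro a b hab
    funext i
    exact Subtype.ext (congrFun (vecMul_injective hN.1 hab) i)
  have hmem : ∀ c : Fin r → F[X], c ᵥ* N ∈ nullLT M k ↔
      ∀ i, c i ∈ degreeLT F (k - rowDeg N i) := by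
    intro c
    rw [mem_nullLT, ← ratVec_mem_rightNullSpace]
    have hV : ratVec (c ᵥ* N) ∈ rightNullSpace M := by
      rw [← hN.2.1, ratVec_vecMul]
      exact Submodule.sum_mem _ fun i _ =>
        Submodule.smul_mem _ _ (Submodule.subset_span ⟨i, rfl⟩)
    constructor
    · intro h i
      by_cases h0 : c i = 0
      · simp [h0]
      · have := hN.natDegree_add_rowDeg_lt h.1 h0
        rw [mem_degreeLT, ← natDegree_lt_iff_degree_lt h0]
        omega
    · refine fun h => ⟨vecMul_mem_degreeLT N fun i h0 => ?_, hV⟩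
      have := h i
      rw [mem_degreeLT, ← natDegree_lt_iff_degree_lt h0] at this
      omega
  have hrange : LinearMap.range f = nullLT M k := by
    ext x
    constructor
    · rintro ⟨c, rfl⟩
      rw [hf, hmem]
      exact fun i => (c i).2
    · intro hx
      obtain ⟨c, rfl⟩ :=
        hN.exists_eq_vecMul ((ratVec_mem_rightNullSpace M x).mpr (mem_nullLT.mp hx).2)
      exact ⟨fun i => ⟨c i, (hmem c).mp hx i⟩, rfl⟩
  rw [← hrange, LinearMap.finrank_range_of_inj hinj, Module.finrank_pi_fintype]
  refine Finset.sum_congr rfl fun i _ => ?_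
  rw [(degreeLTEquiv F _).finrank_eq, Module.finrank_fin_fun]

/-- The right nullity of a Sylvester matrix counts polynomial null vectors. -/
lemma finrank_nullLT_eq_sub_rank_sylv {p q d : ℕ} (M : Matrix (Fin p) (Fin q) F[X])
    (hdeg : ∀ i j, (M i j).natDegree ≤ d) (k : ℕ) :
    Module.finrank F (nullLT M k) = k * q - (sylv d k M).rank := by
  let f : (Fin k × Fin q → F) →ₗ[F] (Fin q → F[X]) :=
    LinearMap.pi fun t => ∑ c : Fin k, (monomial (c : ℕ)) ∘ₗ LinearMap.proj (c, t)
  have hf : ∀ v t, f v t = ∑ c : Fin k, monomial (c : ℕ) (v (c, t)) := fun v t => by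
    simp [f]
  have hcoeff : ∀ v t (c : Fin k), (f v t).coeff c = v (c, t) := fun v t c => by
    rw [hf, finsetSum_coeff]
    simp [coeff_monomial, Fin.val_inj]
  have hdegf : ∀ v t, f v t ∈ degreeLT F k := fun v t => by
    rw [hf]
    refine Submodule.sum_mem _ fun c _ => mem_degreeLT.mpr ?_
    exact (degree_monomial_le _ _).trans_lt (by exact_mod_cast c.2)
  have hinj : Function.Injective f := fun v w hvw => by
    funext ⟨c, t⟩
    rw [← hcoeff v t c, hvw, hcoeff]
  have hsylv : ∀ v (r : Fin (k + d) × Fin p),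
      (sylv d k M *ᵥ v) r = ((M *ᵥ f v) r.2).coeff r.1 := by
    rintro v ⟨r, i⟩
    simp only [Matrix.mulVec, dotProduct, finsetSum_coeff, hf, Fintype.sum_prod_type,
      Finset.mul_sum]
    rw [Finset.sum_comm]
    refine Finset.sum_congr rfl fun t _ => Finset.sum_congr rfl fun c _ => ?_
    rw [← C_mul_X_pow_eq_monomial, ← mul_assoc, coeff_mul_X_pow', coeff_mul_C]
    simp only [sylv]
    split_ifs with h1 h2 h2
    · rfl
    · exact absurd h1.1 h2
    · rw [coeff_eq_zero_of_natDegree_lt, zero_mul]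
      have := hdeg i t
      omega
    · simp
  have hker : ∀ v, sylv d k M *ᵥ v = 0 ↔ M *ᵥ f v = 0 := by
    intro v
    constructor
    · intro h
      funext i
      ext s
      by_cases hs : s < k + d
      · rw [← hsylv v (⟨s, hs⟩, i), h]
        simp
      · simp only [Matrix.mulVec, dotProduct, finsetSum_coeff, Pi.zero_apply, coeff_zero]
        refine Finset.sum_eq_zero fun t _ => ?_
        by_cases h0 : f v t = 0
        · simp [h0]
        · have h1 := hdegf v t
          rw [mem_degreeLT, ← natDegree_lt_iff_degree_lt h0] at h1
          have h2 := hdeg i t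
          have h3 : (M i t * f v t).natDegree ≤ (M i t).natDegree + (f v t).natDegree :=
            natDegree_mul_le
          exact coeff_eq_zero_of_natDegree_lt (by omega)
    · intro h
      funext r
      rw [hsylv, h]
      simp
  have hmap : (LinearMap.ker (sylv d k M).mulVecLin).map f = nullLT M k := by
    ext x
    constructor
    · rintro ⟨v, hv, rfl⟩
      exact ⟨hdegf v, (hker v).mp hv⟩
    · intro hx
      have hfx : f (fun c => (x c.2).coeff c.1) = x := by
        funext t
        ext s
        by_cases hs : s < k
        · exact hcoeff _ t ⟨s, hs⟩
        · have h1 := (degree_lt_iff_coeff_zero _ _).mp (mem_degreeLT.mp (hx.1 t)) s (by omega)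
          rw [h1]
          exact (degree_lt_iff_coeff_zero _ _).mp (mem_degreeLT.mp (hdegf _ t)) s (by omega)
      refine ⟨_, (hker _).mpr ?_, hfx⟩
      rw [hfx]
      exact hx.2
  rw [← hmap, ← (Submodule.equivMapOfInjective f hinj _).finrank_eq]
  have := LinearMap.finrank_range_add_finrank_ker (sylv d k M).mulVecLin
  rw [Module.finrank_fintype_fun_eq_card, Fintype.card_prod, Fintype.card_fin,
    Fintype.card_fin] at this
  rw [Matrix.rank]
  omega

/-- Every rational subspace has a minimal polynomial basis. -/
lemma exists_isMinimalBasisOf {p q : ℕ} (V : Submodule (RatFunc F) (Fin q → RatFunc F))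
    (hV : Module.finrank (RatFunc F) V = p) :
    ∃ N : Matrix (Fin p) (Fin q) F[X], IsMinimalBasisOf V N := by
  let S : Set (Matrix (Fin p) (Fin q) F[X]) :=
    {N | LinearIndependent (RatFunc F) (ratRow N) ∧ rowSpan N = V}
  have hS : S.Nonempty := by
    let b := Module.finBasisOfFinrankEq (RatFunc F) V hV
    have hex : ∀ i, ∃ D : F[X], D ≠ 0 ∧ ∃ x : Fin q → F[X],
        ratVec x = algebraMap F[X] (RatFunc F) D • (b i : Fin q → RatFunc F) := by
      intro i
      obtain ⟨D, hD⟩ := IsLocalization.exist_integer_multiples_of_finite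
        (nonZeroDivisors F[X]) (b i : Fin q → RatFunc F)
      choose x hx using hD
      refine ⟨D, nonZeroDivisors.coe_ne_zero D, x, ?_⟩
      funext t
      rw [algebraMap_smul]
      exact hx t
    choose D hD N hN using hex
    have hli : LinearIndependent (RatFunc F) (ratRow N) := by
      have h1 : LinearIndependent (RatFunc F) fun i => (b i : Fin q → RatFunc F) :=
        b.linearIndependent.map' V.subtype (Submodule.ker_subtype V)
      have h2 := h1.units_smul fun i => Units.mk0 (algebraMap F[X] (RatFunc F) (D i))
        (by simpa using hD i)
      convert h2 using 1
      funext i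
      exact hN i
    refine ⟨N, hli, ?_⟩
    refine Submodule.eq_of_le_of_finrank_eq (Submodule.span_le.mpr ?_) ?_
    · rintro _ ⟨i, rfl⟩
      change ratVec (N i) ∈ V
      rw [hN i]
      exact V.smul_mem _ (b i).2
    · rw [hV]
      exact (finrank_span_eq_card hli).trans (Fintype.card_fin p)
  obtain ⟨N, hN, hmin⟩ := exists_minimalFor_of_wellFoundedLT (· ∈ S)
    (fun N => ∑ i, rowDeg N i) hS
  refine ⟨N, hN.1, hN.2, fun N' h1 h2 => ?_⟩
  by_contra! h
  exact absurd (hmin ⟨h1, h2⟩ h.le) (by simpa using h)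

lemma sum_succ_sub_eq_iff {n : ℕ} (e : Fin n → ℕ) (k : ℕ) :
    ∑ i, (k + 1 - e i) = ∑ i, (k - e i) + n ↔ Finset.univ.sup e ≤ k := by
  have h : ∑ i, (k - e i) + n = ∑ i, (k - e i + 1) := by simp [Finset.sum_add_distrib]
  rw [h, Finset.sum_eq_sum_iff_of_le fun i _ => by omega, Finset.sup_le_iff]
  exact forall₂_congr fun i _ => by omega

/-- If `d'` is the smallest index `k` with `n_{k+1} - n_k = n` (equivalently
`r_{k+1} - r_k = m`), then `d'` is the maximum right minimal index of `M(λ)`, i.e. the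
maximum row degree of any minimal basis of `N_r(M)`; moreover the equalities continue
to hold for every `k ≥ d'`. -/
theorem maxRightMinimalIndex_eq_sylvester_stabilization {F : Type*} [Field F] {m n d : ℕ}
    (hm : 0 < m) (hn : 0 < n) (hd : 0 < d)
    (M : Matrix (Fin m) (Fin (m + n)) F[X]) (hdeg : ∀ i j, (M i j).natDegree ≤ d)
    (hrk : (ratMat M).rank = m) (d' : ℕ)
    (hlow : (d' + 1) * (m + n) - (sylv d (d' + 1) M).rank
        = (d' * (m + n) - (sylv d d' M).rank) + n)
    (hmin : ∀ k < d', ¬((k + 1) * (m + n) - (sylv d (k + 1) M).rank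
        = (k * (m + n) - (sylv d k M).rank) + n)) :
    (∀ N : Matrix (Fin n) (Fin (m + n)) F[X],
        IsMinimalBasisOf (rightNullSpace M) N →
        Finset.univ.sup (fun i => rowDeg N i) = d') ∧
    (∀ k : ℕ, d' ≤ k →
        (k + 1) * (m + n) - (sylv d (k + 1) M).rank
            = (k * (m + n) - (sylv d k M).rank) + n ∧
        (sylv d (k + 1) M).rank = (sylv d k M).rank + m) := by
  have hstep : ∀ N : Matrix (Fin n) (Fin (m + n)) F[X],
      IsMinimalBasisOf (rightNullSpace M) N → ∀ k,
      ((k + 1) * (m + n) - (sylv d (k + 1) M).rank = (k * (m + n) - (sylv d k M).rank) + n ↔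
        Finset.univ.sup (fun i => rowDeg N i) ≤ k) := by
    intro N hN k
    rw [← finrank_nullLT_eq_sub_rank_sylv M hdeg, ← finrank_nullLT_eq_sub_rank_sylv M hdeg,
      hN.finrank_nullLT, hN.finrank_nullLT, sum_succ_sub_eq_iff]
  refine ⟨fun N hN => ?_, fun k hk => ?_⟩
  · refine le_antisymm ((hstep N hN d').mp hlow) ?_
    by_contra! h
    exact hmin _ h ((hstep N hN _).mpr le_rfl)
  · have hdim : Module.finrank (RatFunc F) (rightNullSpace M) = n := by
      have h := LinearMap.finrank_range_add_finrank_ker (ratMat M).mulVecLin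
      rw [Module.finrank_fin_fun] at h
      rw [Matrix.rank] at hrk
      rw [rightNullSpace]
      omega
    obtain ⟨N, hN⟩ := exists_isMinimalBasisOf _ hdim
    have hk1 := (hstep N hN k).mpr (((hstep N hN d').mp hlow).trans hk)
    refine ⟨hk1, ?_⟩
    have hbound : ∀ l, (sylv d l M).rank ≤ l * (m + n) := fun l => by
      simpa using (sylv d l M).rank_le_card_width
    have h1 := hbound k
    have h2 := hbound (k + 1)
    rw [add_mul, one_mul] at hk1 h2
    omega

end
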